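/- In SG_3, with a12 = σ1², a13 = σ2σ1²σ2⁻¹, a23 = σ2², b13 = σ2σ1τ1σ2⁻¹, b23 = σ2τ2, the following four conjugation identities hold: a12⁻¹·a13·a12 = a13·a23·a13·a23⁻¹·a13⁻¹; a12⁻¹·a23·a12 = a13·a23·a13⁻¹; a12⁻¹·b13·a12 = a13·a23·b13·a23⁻¹·a13⁻¹; a12⁻¹·b23·a12 = a13·b23·a13⁻¹. -/

import Mathlib

/-- Defining relations of the singular braid group `SG₃`, as elements of the free
group on four generators `0 ↦ σ₁`, `1 ↦ σ₂`, `2 ↦ τ₁`, `3 ↦ τ₂`. -/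
def sg3Rels : Set (FreeGroup (Fin 4)) :=
  {FreeGroup.of 0 * FreeGroup.of 2 * (FreeGroup.of 2 * FreeGroup.of 0)⁻¹,
   FreeGroup.of 1 * FreeGroup.of 3 * (FreeGroup.of 3 * FreeGroup.of 1)⁻¹,
   FreeGroup.of 0 * FreeGroup.of 1 * FreeGroup.of 0 *
     (FreeGroup.of 1 * FreeGroup.of 0 * FreeGroup.of 1)⁻¹,
   FreeGroup.of 0 * FreeGroup.of 1 * FreeGroup.of 2 *
     (FreeGroup.of 3 * FreeGroup.of 0 * FreeGroup.of 1)⁻¹,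
   FreeGroup.of 1 * FreeGroup.of 0 * FreeGroup.of 3 *
     (FreeGroup.of 2 * FreeGroup.of 1 * FreeGroup.of 0)⁻¹}

/-- The singular braid group on 3 strands. -/
abbrev SG3 : Type := PresentedGroup sg3Rels

def σ1 : SG3 := PresentedGroup.of 0
def σ2 : SG3 := PresentedGroup.of 1
def τ1 : SG3 := PresentedGroup.of 2
def τ2 : SG3 := PresentedGroup.of 3

def a12 : SG3 := σ1 ^ 2
def a13 : SG3 := σ2 * σ1 ^ 2 * σ2⁻¹
def a23 : SG3 := σ2 ^ 2
def b12 : SG3 := σ1 * τ1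
def b13 : SG3 := σ2 * σ1 * τ1 * σ2⁻¹
def b23 : SG3 := σ2 * τ2

theorem sg3_eq_of_rel {u v : FreeGroup (Fin 4)} (h : u * v⁻¹ ∈ sg3Rels) :
    (PresentedGroup.mk sg3Rels u) = PresentedGroup.mk sg3Rels v := by
  have h1 : PresentedGroup.mk sg3Rels (u * v⁻¹) = 1 := PresentedGroup.one_of_mem h
  rw [map_mul, map_inv] at h1
  exact mul_inv_eq_one.mp h1

theorem sg3_c1 : σ1 * τ1 = τ1 * σ1 :=
  sg3_eq_of_rel (u := FreeGroup.of 0 * FreeGroup.of 2) (v := FreeGroup.of 2 * FreeGroup.of 0)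
    (by simp [sg3Rels])

theorem sg3_c2 : σ2 * τ2 = τ2 * σ2 :=
  sg3_eq_of_rel (u := FreeGroup.of 1 * FreeGroup.of 3) (v := FreeGroup.of 3 * FreeGroup.of 1)
    (by simp [sg3Rels])

theorem sg3_braid : σ1 * σ2 * σ1 = σ2 * σ1 * σ2 :=
  sg3_eq_of_rel (u := FreeGroup.of 0 * FreeGroup.of 1 * FreeGroup.of 0)
    (v := FreeGroup.of 1 * FreeGroup.of 0 * FreeGroup.of 1) (by simp [sg3Rels])

theorem sg3_m1 : σ1 * σ2 * τ1 = τ2 * σ1 * σ2 :=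
  sg3_eq_of_rel (u := FreeGroup.of 0 * FreeGroup.of 1 * FreeGroup.of 2)
    (v := FreeGroup.of 3 * FreeGroup.of 0 * FreeGroup.of 1) (by simp [sg3Rels])

theorem sg3_m2 : σ2 * σ1 * τ2 = τ1 * σ2 * σ1 :=
  sg3_eq_of_rel (u := FreeGroup.of 1 * FreeGroup.of 0 * FreeGroup.of 3)
    (v := FreeGroup.of 2 * FreeGroup.of 1 * FreeGroup.of 0) (by simp [sg3Rels])

/-- The half twist. -/
def sg3Delta : SG3 := σ1 * σ2 * σ1

theorem sg3_d1 : sg3Delta * σ1 = σ2 * sg3Delta := by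
  unfold sg3Delta
  calc σ1 * σ2 * σ1 * σ1 = (σ2 * σ1 * σ2) * σ1 := by rw [sg3_braid]
    _ = σ2 * (σ1 * σ2 * σ1) := by group

theorem sg3_d2 : sg3Delta * σ2 = σ1 * sg3Delta := by
  unfold sg3Delta
  calc σ1 * σ2 * σ1 * σ2 = σ1 * (σ2 * σ1 * σ2) := by group
    _ = σ1 * (σ1 * σ2 * σ1) := by rw [sg3_braid]

theorem sg3_d3 : sg3Delta * τ1 = τ2 * sg3Delta := by
  unfold sg3Delta
  rw [mul_assoc, sg3_c1, ← mul_assoc, sg3_m1]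
  simp only [mul_assoc]

theorem sg3_d4 : sg3Delta * τ2 = τ1 * sg3Delta := by
  unfold sg3Delta
  rw [sg3_braid, mul_assoc, sg3_c2, ← mul_assoc, sg3_m2]
  simp only [mul_assoc]

theorem sg3_z {a b : SG3} (h : sg3Delta * a = b * sg3Delta) (k : sg3Delta * b = a * sg3Delta) :
    Commute (sg3Delta * sg3Delta) a := by
  change sg3Delta * sg3Delta * a = a * (sg3Delta * sg3Delta)
  rw [mul_assoc, h, ← mul_assoc, k, mul_assoc]

theorem sg3_full : a12 * (a13 * a23) = sg3Delta * sg3Delta := by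
  unfold a12 a13 a23
  calc σ1 ^ 2 * (σ2 * σ1 ^ 2 * σ2⁻¹ * σ2 ^ 2) = σ1 * (σ1 * σ2 * σ1) * σ1 * σ2 := by
        simp only [pow_two, mul_assoc, inv_mul_cancel_left]
    _ = σ1 * (σ2 * σ1 * σ2) * σ1 * σ2 := by rw [sg3_braid]
    _ = (σ1 * σ2 * σ1) * (σ2 * σ1 * σ2) := by simp only [mul_assoc]
    _ = sg3Delta * sg3Delta := by rw [← sg3_braid]; rfl

/-- Conjugation by `a₁₂⁻¹` is conjugation by `a₁₃ a₂₃`, on anything commuting with the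
full twist. -/
theorem sg3_conj {g : SG3} (h : Commute (sg3Delta * sg3Delta) g) :
    a12⁻¹ * g * a12 = a13 * a23 * g * a23⁻¹ * a13⁻¹ := by
  have e : a13 * a23 = a12⁻¹ * (sg3Delta * sg3Delta) := by rw [← sg3_full]; group
  have e2 : a23⁻¹ * a13⁻¹ = (sg3Delta * sg3Delta)⁻¹ * a12 := by
    rw [← mul_inv_rev, e, mul_inv_rev, inv_inv]
  rw [mul_assoc (a13 * a23 * g), e2, e, mul_assoc a12⁻¹ _ g, h.eq]
  group

/-- Conjugation rules by `a₁₂⁻¹` in `SG₃`. -/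
theorem stmt5 :
    a12⁻¹ * a13 * a12 = a13 * a23 * a13 * a23⁻¹ * a13⁻¹ ∧
    a12⁻¹ * a23 * a12 = a13 * a23 * a13⁻¹ ∧
    a12⁻¹ * b13 * a12 = a13 * a23 * b13 * a23⁻¹ * a13⁻¹ ∧
    a12⁻¹ * b23 * a12 = a13 * b23 * a13⁻¹ := by
  have s1 := sg3_z sg3_d1 sg3_d2
  have s2 := sg3_z sg3_d2 sg3_d1
  have t1 := sg3_z sg3_d3 sg3_d4
  have t2 := sg3_z sg3_d4 sg3_d3
  have hb : a23 * b23 = b23 * a23 := by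
    have c : Commute σ2 τ2 := sg3_c2
    exact ((Commute.refl σ2).mul_right c).pow_left 2
  refine ⟨sg3_conj ?_, ?_, sg3_conj ?_, ?_⟩
  · exact (s2.mul_right (s1.pow_right 2)).mul_right s2.inv_right
  · rw [sg3_conj (g := a23) (s2.pow_right 2 : Commute _ a23)]
    group
  · exact ((s2.mul_right s1).mul_right t1).mul_right s2.inv_right
  · rw [sg3_conj (g := b23) (s2.mul_right t2 : Commute _ b23), mul_assoc a13 a23 b23, hb]
    group
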